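/- arXiv:2305.12360 — 2 statements merged into one kernel-verified Lean document; each statement's English description precedes it below -/
import Mathlib

section
/- Let X be a d-Leray simplicial complex on vertex set V and let A ⊆ V with |A| = d + 1 and A ∉ X. Let U = {v ∈ V \ A : σ ∪ {v} ∈ X for every σ ⊆ A with |σ| = d}. If U is nonempty, then for every a ∈ A, the set U ∪ (A \ {a}) is a face of X. -/
variable {V : Type*} [DecidableEq V] [LinearOrder V]

/-- Chains with `ℤ` coefficients: formal sums of faces of `K` of cardinality `n`
(so `n = 0` corresponds to the empty face, giving the *reduced* chain complex). -/
abbrev Chains (K : Finset V → Prop) (n : ℕ) : Type _ :=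
  {σ : Finset V // K σ ∧ σ.card = n} →₀ ℤ

/-- The simplicial boundary map. -/
noncomputable def bd (K : Finset V → Prop) [DecidablePred K] (n : ℕ) :
    Chains K (n + 1) →ₗ[ℤ] Chains K n :=
  Finsupp.lsum ℤ fun σ : {σ : Finset V // K σ ∧ σ.card = n + 1} =>
    LinearMap.toSpanSingleton ℤ (Chains K n)
      (∑ v ∈ σ.1.attach,
        if h : K (σ.1.erase v.1) then
          ((-1 : ℤ) ^ ((σ.1.filter (fun w => w < v.1)).card)) •
            Finsupp.single (⟨σ.1.erase v.1, h, by
              rw [Finset.card_erase_of_mem v.2, σ.2.2]; omega⟩ :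
              {τ : Finset V // K τ ∧ τ.card = n}) (1 : ℤ)
        else 0)

/-- Cycles: kernel of the boundary map (everything in the bottom degree). -/
noncomputable def cycles (K : Finset V → Prop) [DecidablePred K] :
    (n : ℕ) → Submodule ℤ (Chains K n)
  | 0 => ⊤
  | (m + 1) => LinearMap.ker (bd K m)

/-- Reduced homology: `RHom K n` is the reduced simplicial homology of `K`
in dimension `n - 1` (so `RHom K (i+1)` is `H̃ᵢ(K)`). -/
noncomputable abbrev RHom (K : Finset V → Prop) [DecidablePred K] (n : ℕ) : Type _ :=
  (cycles K n) ⧸ (Submodule.comap (cycles K n).subtype (LinearMap.range (bd K n)))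

/-- A complex is `d`-Leray if every induced subcomplex has trivial reduced homology
in dimensions `d` and higher. -/
def IsDLeray (d : ℕ) (K : Finset V → Prop) [DecidablePred K] : Prop :=
  ∀ (W : Finset V) (i : ℕ), d ≤ i →
    Subsingleton (RHom (fun σ => K σ ∧ σ ⊆ W) (i + 1))

/-- The incidence sign. -/
def sg {V : Type*} [LinearOrder V] (v : V) (T : Finset V) : ℤ :=
  (-1 : ℤ) ^ ((T.filter (fun w => w < v)).card)

/-- Boundary on the full simplex, acting on coefficient functions. -/
def DD {V : Type*} [DecidableEq V] [LinearOrder V] [Fintype V] (f : Finset V → ℤ)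
    (T : Finset V) : ℤ :=
  ∑ v : V, if v ∈ T then 0 else sg v T * f (insert v T)

/-- Coefficient function of a chain. -/
noncomputable def coefFn {V : Type*} (L : Finset V → Prop) (n : ℕ) (f : Chains L n)
    (S : Finset V) : ℤ :=
  open Classical in if h : L S ∧ S.card = n then f ⟨S, h⟩ else 0

theorem sg_sq {V : Type*} [LinearOrder V] (v : V) (T : Finset V) : sg v T * sg v T = 1 := by
  unfold sg
  rw [← mul_pow]; simp

theorem sg_insert {V : Type*} [DecidableEq V] [LinearOrder V] (v w : V) (T : Finset V)
    (hv : v ∉ T) :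
    sg w (insert v T) = (if v < w then -1 else 1) * sg w T := by
  unfold sg
  rw [Finset.filter_insert]
  split_ifs with h
  · rw [Finset.card_insert_of_notMem (by simp [hv]), pow_succ]; ring
  · simp

theorem DD_DD {V : Type*} [DecidableEq V] [LinearOrder V] [Fintype V] (f : Finset V → ℤ)
    (T : Finset V) : DD (DD f) T = 0 := by
  have key : DD (DD f) T = ∑ p : V × V, if p.1 ∈ T ∨ p.2 ∈ insert p.1 T then 0 else
      sg p.1 T * (sg p.2 (insert p.1 T) * f (insert p.2 (insert p.1 T))) := by
    rw [Fintype.sum_prod_type]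
    unfold DD
    refine Finset.sum_congr rfl fun v _ => ?_
    by_cases hv : v ∈ T
    · simp [hv]
    · simp only [hv, if_false, false_or, Finset.mul_sum]
      refine Finset.sum_congr rfl fun w _ => ?_
      split_ifs <;> simp
  rw [key]
  refine Finset.sum_involution (fun p _ => (p.2, p.1)) ?_ ?_ (by simp) (by simp)
  · rintro ⟨v, w⟩ -
    by_cases hv : v ∈ T
    · simp [hv]
    by_cases hw : w ∈ T
    · simp [hw]
    by_cases hvw : v = w
    · simp [hvw]
    have hwv : ¬ w = v := fun h => hvw h.symm
    simp only [hv, hw, Finset.mem_insert, hvw, hwv, or_self, if_false]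
    rw [sg_insert v w T hv, sg_insert w v T hw, Finset.insert_comm]
    rcases lt_or_gt_of_ne hvw with h | h
    · rw [if_pos h, if_neg (not_lt_of_gt h)]; ring
    · rw [if_pos h, if_neg (not_lt_of_gt h)]; ring
  · rintro ⟨v, w⟩ - h1 h2
    simp only [Prod.mk.injEq] at h2
    apply h1
    simp [h2.1]

theorem DD_add {V : Type*} [DecidableEq V] [LinearOrder V] [Fintype V] (f g : Finset V → ℤ)
    (T : Finset V) : DD (fun S => f S + g S) T = DD f T + DD g T := by
  unfold DD
  rw [← Finset.sum_add_distrib]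
  refine Finset.sum_congr rfl fun v _ => ?_
  split_ifs
  · simp
  · ring

theorem DD_ne {V : Type*} [DecidableEq V] [LinearOrder V] [Fintype V] (f : Finset V → ℤ)
    (T : Finset V) (h : DD f T ≠ 0) : ∃ v, v ∉ T ∧ f (insert v T) ≠ 0 := by
  unfold DD at h
  obtain ⟨v, _, hv⟩ := Finset.exists_ne_zero_of_sum_ne_zero h
  refine ⟨v, ?_, ?_⟩
  · intro hm; simp [hm] at hv
  · intro hm; simp [hm] at hv

theorem coefFn_bd {V : Type*} [DecidableEq V] [LinearOrder V] [Fintype V] (L : Finset V → Prop)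
    [DecidablePred L] (n : ℕ) (f : Chains L (n + 1)) (T : Finset V) (hT : L T ∧ T.card = n) :
    (bd L n f) ⟨T, hT⟩ = DD (coefFn L (n + 1) f) T := by
  classical
  induction f using Finsupp.induction_linear with
  | zero => simp [DD, coefFn]
  | add f g hf hg =>
    rw [map_add, Finsupp.add_apply, hf, hg, ← DD_add]
    congr 1
    funext S
    unfold coefFn
    split_ifs <;> simp
  | single σ r =>
    obtain ⟨σ, hσ⟩ := σ
    have e1 : (bd L n (Finsupp.single ⟨σ, hσ⟩ r)) ⟨T, hT⟩ =
        ∑ v ∈ σ.attach, if σ.erase v.1 = T then r * sg v.1 σ else 0 := by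
      simp only [bd, Finsupp.lsum_single, LinearMap.toSpanSingleton_apply, Finsupp.smul_apply,
        Finsupp.finsetSum_apply, Finset.smul_sum]
      refine Finset.sum_congr rfl fun v _ => ?_
      by_cases h : σ.erase v.1 = T
      · have : L (σ.erase v.1) := h ▸ hT.1
        simp [h, hT.1, sg]
      · by_cases h' : L (σ.erase v.1)
        · simp [h, h']
        · simp [h, h']
    rw [e1, Finset.sum_attach σ (fun v => if σ.erase v = T then r * sg v σ else 0),
      ← Finset.sum_filter]
    unfold DD
    rw [← Finset.sum_filter_add_sum_filter_not Finset.univ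
      (fun v => v ∈ σ ∧ σ.erase v = T)]
    have e2 : (Finset.univ.filter (fun v => v ∈ σ ∧ σ.erase v = T)) =
        σ.filter (fun v => σ.erase v = T) := by ext; simp
    rw [e2]
    symm
    rw [← add_zero (∑ a ∈ σ with σ.erase a = T, r * sg a σ)]
    congr 1
    · refine Finset.sum_congr rfl fun v hv => ?_
      rw [Finset.mem_filter] at hv
      obtain ⟨hv, rfl⟩ := hv
      rw [if_neg (by simp), Finset.insert_erase hv]
      have : sg v (σ.erase v) = sg v σ := by
        conv_rhs => rw [← Finset.insert_erase hv, sg_insert _ _ _ (by simp)]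
        simp
      rw [this, coefFn, dif_pos hσ]
      simp [mul_comm]
    · refine Finset.sum_eq_zero fun v hv => ?_
      rw [Finset.mem_filter] at hv
      split_ifs with h
      · rfl
      · have : σ ≠ insert v T := by
          rintro rfl
          exact hv.2 ⟨by simp, by simp [h]⟩
        unfold coefFn
        split_ifs
        · simp [this]
        · simp

theorem main_step {V : Type*} [DecidableEq V] [LinearOrder V] [Fintype V]
    (d : ℕ) (K : Finset V → Prop) [DecidablePred K]
    (hcomplex : ∀ ⦃σ τ : Finset V⦄, K τ → σ ⊆ τ → K σ)
    (hLeray : IsDLeray d K)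
    (A : Finset V) (hA : A.card = d + 1) (hAX : ¬ K A)
    (U : Finset V) (hdisj : Disjoint A U) (hU2 : 2 ≤ U.card)
    (IH : ∀ u ∈ U, ∀ a ∈ A, K (U.erase u ∪ A.erase a)) (a : V) (ha : a ∈ A) :
    K (U ∪ A.erase a) := by
  classical
  obtain ⟨k, hk⟩ : ∃ k, U.card = k + 2 := ⟨U.card - 2, by omega⟩
  set W := A ∪ U with hW
  have hWc : W.card = d + k + 3 := by
    rw [hW, Finset.card_union_of_disjoint hdisj]; omega
  by_contra hcon
  have hL := hLeray W (d + k) (by omega)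
  set L : Finset V → Prop := fun σ => K σ ∧ σ ⊆ W with hLdef
  -- the full chain
  let g : Finset V → ℤ := DD (fun S => if S = W then 1 else 0)
  have hg : ∀ S, g S ≠ 0 → S ⊆ W ∧ S.card = d + k + 2 := by
    intro S hS
    obtain ⟨v, hv, h⟩ := DD_ne _ _ hS
    have h' : insert v S = W := by
      by_contra h'; simp [h'] at h
    constructor
    · rw [← h']; exact Finset.subset_insert _ _
    · have := congrArg Finset.card h'
      rw [Finset.card_insert_of_notMem hv] at this
      omega
  let c : Finset V → ℤ := fun S => if A ⊆ S then 0 else g S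
  let c' : Finset V → ℤ := fun S => if A ⊆ S then g S else 0
  have hcc : (fun S => c S + c' S) = g := by
    funext S; simp only [c, c']; split_ifs <;> simp
  have hDcc : ∀ T, DD c T + DD c' T = 0 := by
    intro T; rw [← DD_add, hcc]; exact DD_DD _ _
  have hz : ∀ T, DD c T ≠ 0 → L T ∧ T.card = d + k + 1 := by
    intro T hT
    have hT' : DD c' T ≠ 0 := by
      intro h; apply hT; have := hDcc T; omega
    obtain ⟨v, hv, h1⟩ := DD_ne _ _ hT
    obtain ⟨w, hw, h2⟩ := DD_ne _ _ hT'
    have hA1 : ¬ A ⊆ insert v T := by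
      intro h; simp [c, h] at h1
    have hg1 := hg (insert v T) (by simpa [c, hA1] using h1)
    have hA2 : A ⊆ insert w T := by
      by_contra h; simp [c', h] at h2
    have hg2 := hg (insert w T) (by simpa [c', hA2] using h2)
    rw [Finset.card_insert_of_notMem hv] at hg1
    obtain ⟨b, hbA, hb⟩ := Finset.not_subset.1 hA1
    have hU' : ¬ U ⊆ insert w T := by
      intro h
      have := Finset.card_le_card (Finset.union_subset hA2 h)
      rw [Finset.card_insert_of_notMem hw, ← hW] at this
      omega
    obtain ⟨u, huU, hu⟩ := Finset.not_subset.1 hU'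
    have hTW : T ⊆ W := (Finset.subset_insert _ _).trans hg1.1
    refine ⟨⟨hcomplex (IH u huU b hbA) ?_, hTW⟩, by omega⟩
    intro x hx
    have hxb : x ≠ b := by rintro rfl; exact hb (Finset.mem_insert_of_mem hx)
    have hxu : x ≠ u := by rintro rfl; exact hu (Finset.mem_insert_of_mem hx)
    have := hTW hx
    simp only [hW, Finset.mem_union, Finset.mem_erase] at this ⊢
    tauto
  let z : Chains L (d + k + 1) := Finsupp.equivFunOnFinite.symm (fun S => DD c S.1)
  have hcoefz : coefFn L (d + k + 1) z = DD c := by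
    funext T
    unfold coefFn
    split_ifs with h
    · rfl
    · by_contra h'
      exact h (hz T (fun h'' => h' h''.symm))
  have hzc : z ∈ cycles L (d + k + 1) := by
    change bd L (d + k) z = 0
    ext ⟨T, hT⟩
    rw [coefFn_bd, hcoefz, DD_DD]; rfl
  have hzr : z ∈ LinearMap.range (bd L (d + k + 1)) := by
    have := Submodule.Quotient.subsingleton_iff.1 hL
    have h2 : (⟨z, hzc⟩ : cycles L (d + k + 1)) ∈ (⊤ : Submodule ℤ (cycles L (d + k + 1))) :=
      trivial
    rw [← this] at h2
    exact h2
  obtain ⟨b, hb⟩ := hzr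
  obtain ⟨u, huU⟩ : U.Nonempty := Finset.card_pos.1 (by omega)
  have huA : u ∉ A := fun h => Finset.disjoint_left.1 hdisj h huU
  have haU : a ∉ U := fun h => Finset.disjoint_left.1 hdisj ha h
  have hau : a ≠ u := by rintro rfl; exact huA ha
  have haW : a ∈ W := Finset.mem_union_left _ ha
  have huW : u ∈ W := Finset.mem_union_right _ huU
  set T := (W.erase a).erase u with hTdef
  have hTL : L T ∧ T.card = d + k + 1 := by
    constructor
    · refine ⟨hcomplex (IH u huU a ha) ?_, ?_⟩
      · intro x hx
        simp only [hTdef, hW, Finset.mem_union, Finset.mem_erase] at hx ⊢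
        tauto
      · exact (Finset.erase_subset _ _).trans (Finset.erase_subset _ _)
    · rw [hTdef, Finset.card_erase_of_mem (by simp [hau.symm, huW]),
        Finset.card_erase_of_mem haW]
      omega
  have hiu : insert u T = W.erase a := Finset.insert_erase (by simp [hau.symm, huW])
  have hia : insert a T = W.erase u := by
    rw [hTdef, Finset.erase_right_comm]; exact Finset.insert_erase (by simp [hau, haW])
  have hAWu : A ⊆ W.erase u := by
    intro x hx
    rw [Finset.mem_erase]
    exact ⟨by rintro rfl; exact huA hx, Finset.mem_union_left _ hx⟩
  have hAWa : ¬ A ⊆ W.erase a := fun h => by simpa using h ha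
  have h1 : DD (coefFn L (d + k + 1 + 1) b) T = 0 := by
    by_contra h
    obtain ⟨v, hv, h⟩ := DD_ne _ _ h
    have hLv : L (insert v T) := by
      by_contra h'
      simp [coefFn, h'] at h
    have hvW : v ∈ W := hLv.2 (Finset.mem_insert_self _ _)
    by_cases hva : v = a
    · subst hva
      rw [hia] at hLv
      exact hAX (hcomplex hLv.1 hAWu)
    by_cases hvu : v = u
    · subst hvu
      rw [hiu] at hLv
      refine hcon (hcomplex hLv.1 ?_)
      intro x hx
      have : x ∈ U → x ≠ a := fun hxU hxa => haU (hxa ▸ hxU)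
      simp only [hW, Finset.mem_union, Finset.mem_erase] at hx ⊢
      tauto
    · exact hv (by simp [hTdef, hva, hvu, hvW])
  have h2 : DD c T = 0 := by
    rw [← h1, ← coefFn_bd L _ b T hTL, hb]; rfl
  -- but the coefficient is a unit
  have hgs : g (W.erase a) = sg a (W.erase a) := by
    simp only [g, DD]
    rw [Finset.sum_eq_single a]
    · simp [Finset.insert_erase haW]
    · intro v _ hva
      split_ifs with h h'
      · rfl
      · have : a ∈ insert v (W.erase a) := by rw [h']; exact haW
        simp [Ne.symm hva] at this
      · simp
    · simp
  have h3 : DD c T = sg u T * sg a (W.erase a) := by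
    simp only [DD]
    rw [Finset.sum_eq_single u]
    · rw [if_neg (by simp [hTdef]), hiu]
      simp only [c]
      rw [if_neg hAWa, hgs]
    · intro v _ hvu
      split_ifs with h
      · rfl
      · have : c (insert v T) = 0 := by
          by_contra h'
          by_cases hva : v = a
          · subst hva
            rw [hia] at h'
            simp [c, hAWu] at h'
          · have hA1 : ¬ A ⊆ insert v T := by
              intro hh; simp [c, hh] at h'
            have := (hg (insert v T) (by simpa [c, hA1] using h')).1 (Finset.mem_insert_self _ _)
            exact h (by simp [hTdef, hva, hvu, this])
        rw [this, mul_zero]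
    · simp
  rw [h2] at h3
  have e1 := sg_sq u T
  have e2 := sg_sq a (W.erase a)
  rcases mul_eq_zero.1 h3.symm with h | h
  · rw [h] at e1; simp at e1
  · rw [h] at e2; simp at e2

/-- If `X` is `d`-Leray, `A` is a non-face of size `d+1`, and `U` is the set of vertices
outside `A` joined to every `d`-subset of `A`, then (if `U ≠ ∅`) for every `a ∈ A`,
`U ∪ (A \ {a})` is a face of `X`. -/
theorem stmt_7 {V : Type*} [DecidableEq V] [LinearOrder V] [Fintype V]
    (d : ℕ) (K : Finset V → Prop) [DecidablePred K]
    (hcomplex : ∀ ⦃σ τ : Finset V⦄, K τ → σ ⊆ τ → K σ)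
    (hLeray : IsDLeray d K)
    (A : Finset V) (hA : A.card = d + 1) (hAX : ¬ K A)
    (U : Finset V)
    (hU : ∀ v : V, v ∈ U ↔ (v ∉ A ∧ ∀ σ ⊆ A, σ.card = d → K (insert v σ)))
    (hUne : U.Nonempty) :
    ∀ a ∈ A, K (U ∪ (A.erase a)) := by
  have main : ∀ U' : Finset V, U' ⊆ U → U'.Nonempty → ∀ a ∈ A, K (U' ∪ A.erase a) := by
    intro U'
    induction U' using Finset.strongInduction with
    | H U' ih =>
      intro hsub hne a ha
      by_cases h1 : U'.card = 1
      · obtain ⟨u, rfl⟩ := Finset.card_eq_one.1 h1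
        have := ((hU u).1 (hsub (by simp))).2 (A.erase a) (Finset.erase_subset _ _)
          (by rw [Finset.card_erase_of_mem ha]; omega)
        exact this
      · have hpos := Finset.card_pos.2 hne
        refine main_step d K hcomplex hLeray A hA hAX U' ?_ (by omega) ?_ a ha
        · rw [Finset.disjoint_right]
          intro x hx
          exact ((hU x).1 (hsub hx)).1
        · intro u hu b hb
          refine ih _ (Finset.erase_ssubset hu) ((Finset.erase_subset _ _).trans hsub) ?_ b hb
          rw [← Finset.card_pos, Finset.card_erase_of_mem hu]
          omega
  exact main U (Finset.Subset.refl _) hUne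
end

section
/- Let X be a d-Leray simplicial complex on vertex set V, M a matroid on V of rank r ≥ d + 1 with rank function ρ, and 1 ≤ k ≤ d + 1. Assume that X contains every set σ ⊆ V of size d + 1 with ρ(σ) ≥ k. Then there exists τ ∈ X such that ρ(V \ τ) ≤ k − 1. -/
/-- `Ind` is (the independence predicate of) a matroid. -/
structure IsMatroid {V : Type*} [DecidableEq V] (Ind : Finset V → Prop) : Prop where
  empty : Ind ∅
  subset : ∀ ⦃σ τ : Finset V⦄, Ind τ → σ ⊆ τ → Ind σ
  exchange : ∀ ⦃A B : Finset V⦄, Ind A → Ind B → A.card < B.card →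
    ∃ x ∈ B, x ∉ A ∧ Ind (insert x A)

/-- The rank of `W`: the maximal size of an independent subset of `W`. -/
def matRank {V : Type*} [DecidableEq V] (Ind : Finset V → Prop) [DecidablePred Ind]
    (W : Finset V) : ℕ :=
  (W.powerset.filter Ind).sup Finset.card

variable {V : Type*} [DecidableEq V] [LinearOrder V]

set_option linter.unusedSectionVars false
namespace LerayAux
open Finset Matrix

section ext
variable {Q : Type*} [LinearOrder Q] [Fintype Q]

/-- Sign of `v` relative to `s`. -/
def sg (s : Finset Q) (v : Q) : ℚ := (-1) ^ (s.filter (fun w => w < v)).card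

/-- Matrix of the simplicial coboundary of the full simplex. -/
def Bm (Q : Type*) [LinearOrder Q] [Fintype Q] : Matrix (Finset Q) (Finset Q) ℚ :=
  fun s t => ∑ v ∈ s, if t = s.erase v then sg s v else 0

/-- Matrix of the contraction with `x`. -/
def Hm (x : Q) : Matrix (Finset Q) (Finset Q) ℚ :=
  fun s t => if x ∈ s then 0 else if t = insert x s then sg s x else 0

lemma Bm_mulVec (φ : Finset Q → ℚ) (s : Finset Q) :
    (Bm Q *ᵥ φ) s = ∑ v ∈ s, sg s v * φ (s.erase v) := by
  simp only [Matrix.mulVec, dotProduct, Bm, Finset.sum_mul]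
  rw [Finset.sum_comm]
  refine Finset.sum_congr rfl fun v _ => ?_
  simp [ite_mul]

lemma Hm_mulVec (x : Q) (φ : Finset Q → ℚ) (s : Finset Q) :
    (Hm x *ᵥ φ) s = if x ∈ s then 0 else sg s x * φ (insert x s) := by
  simp only [Matrix.mulVec, dotProduct, Hm]
  split_ifs <;> simp [ite_mul]

lemma vecMul_Bm (φ : Finset Q → ℚ) (t : Finset Q) :
    (φ ᵥ* Bm Q) t = ∑ v ∈ tᶜ, sg (insert v t) v * φ (insert v t) := by
  simp only [Matrix.vecMul, dotProduct, Bm, Finset.mul_sum]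
  have : ∀ s : Finset Q, (∑ v ∈ s, φ s * (if t = s.erase v then sg s v else 0))
      = ∑ v : Q, if v ∈ tᶜ ∧ s = insert v t then sg s v * φ s else 0 := by
    intro s
    rw [← Finset.sum_filter_add_sum_filter_not univ (fun v => v ∈ s)]
    have h2 : (∑ v ∈ univ.filter (fun v => ¬ v ∈ s),
        if v ∈ tᶜ ∧ s = insert v t then sg s v * φ s else 0) = 0 := by
      refine Finset.sum_eq_zero fun v hv => ?_
      rw [if_neg]
      rintro ⟨_, h⟩
      simp only [mem_filter, h] at hv
      simp at hv
    rw [h2, add_zero]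
    have : univ.filter (fun v => v ∈ s) = s := by ext; simp
    rw [this]
    refine Finset.sum_congr rfl fun v hv => ?_
    have hiff : t = s.erase v ↔ (v ∈ tᶜ ∧ s = insert v t) := by
      constructor
      · rintro rfl
        simp [Finset.insert_erase hv]
      · rintro ⟨h, rfl⟩
        rw [Finset.erase_insert]; simpa using h
    by_cases h : t = s.erase v
    · rw [if_pos h, if_pos (hiff.1 h), mul_comm]
    · rw [if_neg h, if_neg (fun h' => h (hiff.2 h')), mul_zero]
  simp_rw [this]
  rw [Finset.sum_comm]
  have h3 : ∀ v : Q, (∑ s : Finset Q, if v ∈ tᶜ ∧ s = insert v t then sg s v * φ s else 0)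
      = if v ∈ tᶜ then sg (insert v t) v * φ (insert v t) else 0 := by
    intro v
    by_cases h : v ∈ tᶜ <;> simp [h]
  simp_rw [h3]
  rw [← Finset.sum_filter]
  congr 1; ext; simp

lemma vecMul_Hm (x : Q) (φ : Finset Q → ℚ) (t : Finset Q) (h : (φ ᵥ* Hm x) t ≠ 0) :
    ∃ s, φ s ≠ 0 ∧ x ∉ s ∧ t = insert x s := by
  simp only [Matrix.vecMul, dotProduct] at h
  obtain ⟨s, _, hs⟩ := Finset.exists_ne_zero_of_sum_ne_zero h
  refine ⟨s, left_ne_zero_of_mul hs, ?_⟩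
  have := right_ne_zero_of_mul hs
  unfold Hm at this
  split_ifs at this with h1 h2
  · simp at this
  · exact ⟨h1, h2⟩
  · simp at this

lemma sg_mul_self (s : Finset Q) (v : Q) : sg s v * sg s v = 1 := by
  unfold sg; rw [← mul_pow]; norm_num

lemma sg_ne_zero (s : Finset Q) (v : Q) : sg s v ≠ 0 := by
  unfold sg; exact pow_ne_zero _ (by norm_num)

lemma sg_erase_self (s : Finset Q) (v : Q) : sg (s.erase v) v = sg s v := by
  unfold sg; congr 2; ext w; simp only [mem_filter, mem_erase]
  constructor
  · rintro ⟨⟨_, h⟩, h'⟩; exact ⟨h, h'⟩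
  · rintro ⟨h, h'⟩; exact ⟨⟨ne_of_lt h', h⟩, h'⟩

lemma sg_insert_self (s : Finset Q) (v : Q) : sg (insert v s) v = sg s v := by
  rw [← sg_erase_self]
  unfold sg; congr 2; ext w; simp only [mem_filter, mem_erase, mem_insert]
  constructor
  · rintro ⟨⟨h1, h⟩, h'⟩; exact ⟨h.resolve_left h1, h'⟩
  · rintro ⟨h, h'⟩; exact ⟨⟨ne_of_lt h', Or.inr h⟩, h'⟩

lemma sg_insert (s : Finset Q) (x v : Q) (hx : x ∉ s) :
    sg (insert x s) v = (if x < v then -1 else 1) * sg s v := by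
  unfold sg
  rw [Finset.filter_insert]
  split_ifs with h
  · rw [Finset.card_insert_of_notMem (by simp [hx]), pow_succ]; ring
  · simp

lemma sg_comm (s : Finset Q) (x v : Q) (hx : x ∉ s) (hv : v ∈ s) :
    sg s x * sg (insert x s) v = - (sg s v * sg (s.erase v) x) := by
  have hxv : x ≠ v := fun h => hx (h ▸ hv)
  have e : s = insert v (s.erase v) := (Finset.insert_erase hv).symm
  have h1 : sg s x = (if v < x then -1 else 1) * sg (s.erase v) x := by
    conv_lhs => rw [e]
    exact sg_insert _ _ _ (by simp)
  rw [sg_insert s x v hx, h1]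
  rcases lt_or_gt_of_ne hxv with h | h
  · simp [h, not_lt_of_gt h]; ring
  · simp [h, not_lt_of_gt h]; ring

lemma con_cob (x : Q) (φ : Finset Q → ℚ) :
    Hm x *ᵥ (Bm Q *ᵥ φ) + Bm Q *ᵥ (Hm x *ᵥ φ) = φ := by
  ext s
  simp only [Pi.add_apply]
  rw [Hm_mulVec, Bm_mulVec (Hm x *ᵥ φ)]
  by_cases hx : x ∈ s
  · rw [if_pos hx, zero_add, Finset.sum_eq_single x]
    · rw [Hm_mulVec, if_neg (by simp), sg_erase_self, Finset.insert_erase hx, ← mul_assoc,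
        sg_mul_self, one_mul]
    · intro v _ hvx
      rw [Hm_mulVec, if_pos (by simp [hx, hvx.symm]), mul_zero]
    · intro h; exact absurd hx h
  · rw [if_neg hx, Bm_mulVec, Finset.sum_insert hx, mul_add, Finset.erase_insert hx,
      sg_insert_self, ← mul_assoc, sg_mul_self, one_mul, add_assoc, Finset.mul_sum,
      ← Finset.sum_add_distrib, Finset.sum_eq_zero, add_zero]
    intro v hv
    have hxv : x ≠ v := fun h => hx (h ▸ hv)
    rw [Hm_mulVec, if_neg (by simp [hx]), ← mul_assoc, sg_comm s x v hx hv,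
      Finset.erase_insert_of_ne hxv]
    ring

lemma cob_cob (φ : Finset Q → ℚ) : Bm Q *ᵥ (Bm Q *ᵥ φ) = 0 := by
  suffices h : ∀ n : ℕ, ∀ (s : Finset Q) (φ : Finset Q → ℚ), s.card = n →
      (Bm Q *ᵥ (Bm Q *ᵥ φ)) s = 0 by
    ext s; exact h _ s φ rfl
  intro n
  induction n with
  | zero =>
    intro s φ hs
    rw [Finset.card_eq_zero] at hs
    subst hs
    simp [Bm_mulVec]
  | succ n ih =>
    intro s φ hs
    obtain ⟨x, hx⟩ : s.Nonempty := by rw [← Finset.card_pos]; omega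
    have h1 := con_cob x (Bm Q *ᵥ φ)
    have h2 : Bm Q *ᵥ (Hm x *ᵥ (Bm Q *ᵥ φ)) =
        Bm Q *ᵥ φ - Bm Q *ᵥ (Bm Q *ᵥ (Hm x *ᵥ φ)) := by
      rw [← Matrix.mulVec_sub]
      congr 1
      exact eq_sub_of_add_eq (con_cob x φ)
    have h3 : Hm x *ᵥ (Bm Q *ᵥ (Bm Q *ᵥ φ)) = Bm Q *ᵥ (Bm Q *ᵥ (Hm x *ᵥ φ)) := by
      rw [h2] at h1
      have := eq_sub_of_add_eq h1
      rw [this]; abel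
    have h4 := congrFun h3 (s.erase x)
    rw [Hm_mulVec, if_neg (by simp), Finset.insert_erase hx,
      ih (s.erase x) _ (by rw [Finset.card_erase_of_mem hx]; omega)] at h4
    exact (mul_eq_zero.1 h4).resolve_left (sg_ne_zero _ _)

lemma Bm_sq : Bm Q * Bm Q = 0 := by
  apply Matrix.toLin'.injective
  refine LinearMap.ext fun v => ?_
  rw [Matrix.toLin'_apply, ← Matrix.mulVec_mulVec, cob_cob]
  simp

lemma HB (x : Q) : Hm x * Bm Q + Bm Q * Hm x = 1 := by
  apply Matrix.toLin'.injective
  refine LinearMap.ext fun v => ?_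
  rw [Matrix.toLin'_apply, Matrix.add_mulVec, ← Matrix.mulVec_mulVec, ← Matrix.mulVec_mulVec,
    con_cob]
  simp

end ext

lemma exists_rec {α β : Type*} [Inhabited β] (sz : α → ℕ) (Good : (α → β) → α → β → Prop)
    (hext : ∀ f f' a y, (∀ b, sz b < sz a → f b = f' b) → Good f a y → Good f' a y)
    (hstep : ∀ f a, (∀ b, sz b < sz a → Good f b (f b)) → ∃ y, Good f a y) :
    ∃ f : α → β, ∀ a, Good f a (f a) := by
  classical
  let F : α → β := (measure sz).wf.fix (fun a rec =>
    let f0 : α → β := fun b => if h : sz b < sz a then rec b h else default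
    if h : ∃ y, Good f0 a y then h.choose else default)
  refine ⟨F, ?_⟩
  suffices h : ∀ n a, sz a = n → Good F a (F a) from fun a => h _ a rfl
  intro n
  induction n using Nat.strong_induction_on with
  | _ n ih =>
    intro a ha
    have hF : F a = (let f0 : α → β := fun b => if h : sz b < sz a then F b else default
        if h : ∃ y, Good f0 a y then h.choose else default) := by
      exact (measure sz).wf.fix_eq _ a
    have hag : ∀ b, sz b < sz a →
        (fun b => if h : sz b < sz a then F b else default) b = F b := by
      intro b hb; simp [hb]
    have hex : ∃ y, Good (fun b => if h : sz b < sz a then F b else default) a y := by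
      obtain ⟨y, hy⟩ := hstep F a (fun b hb => ih _ (ha ▸ hb) b rfl)
      exact ⟨y, hext _ _ _ _ (fun b hb => (hag b hb).symm) hy⟩
    simp only [dif_pos hex] at hF
    rw [hF]
    exact hext _ _ _ _ hag hex.choose_spec

lemma trace_lemma {ι : Type*} [Fintype ι] [DecidableEq ι] (J B h Φ π : Matrix ι ι ℚ)
    (h1 : h * B + B * h = π) (h2 : Φ * π = Φ) (h3 : Φ * B = B * Φ) (h4 : J * B = -(B * J)) :
    Matrix.trace (J * Φ) = 0 := by
  have e1 : Matrix.trace (J * Φ * (h * B)) = - Matrix.trace (J * Φ * (B * h)) := by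
    calc Matrix.trace (J * Φ * (h * B)) = Matrix.trace ((J * Φ * h) * B) := by
          simp only [Matrix.mul_assoc]
      _ = Matrix.trace (B * (J * Φ * h)) := Matrix.trace_mul_comm _ _
      _ = Matrix.trace ((B * J) * (Φ * h)) := by simp only [Matrix.mul_assoc]
      _ = Matrix.trace (-(J * B) * (Φ * h)) := by rw [h4, neg_neg]
      _ = - Matrix.trace (J * (B * Φ) * h) := by
          rw [Matrix.neg_mul, Matrix.trace_neg]; simp only [Matrix.mul_assoc]
      _ = - Matrix.trace (J * Φ * (B * h)) := by rw [← h3]; simp only [Matrix.mul_assoc]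
  calc Matrix.trace (J * Φ) = Matrix.trace (J * Φ * (h * B + B * h)) := by
        rw [h1, Matrix.mul_assoc, h2]
    _ = 0 := by rw [Matrix.mul_add, Matrix.trace_add, e1]; ring

section top
variable {U Q : Type*} [LinearOrder U] [Fintype U] [LinearOrder Q] [Fintype Q]

/-- `s` is a chain with respect to the labels. -/
def Ch (lab : Q → Finset U) (s : Finset Q) : Prop :=
  ∀ x ∈ s, ∀ y ∈ s, lab x ⊆ lab y ∨ lab y ⊆ lab x


lemma Ch.subset {lab : Q → Finset U} {s t : Finset Q} (h : Ch lab t) (hst : s ⊆ t) : Ch lab s :=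
  fun x hx y hy => h x (hst hx) y (hst hy)

lemma Ch.insert {lab : Q → Finset U} {s : Finset Q} {x : Q} (h : Ch lab s)
    (hx : ∀ y ∈ s, lab x ⊆ lab y ∨ lab y ⊆ lab x) : Ch lab (insert x s) := by
  intro a ha b hb
  rw [Finset.mem_insert] at ha hb
  rcases ha with rfl | ha
  · rcases hb with rfl | hb
    · exact Or.inl subset_rfl
    · exact hx b hb
  · rcases hb with rfl | hb
    · exact (hx a ha).symm
    · exact h a ha b hb

lemma Ch.exists_min {lab : Q → Finset U} {s : Finset Q} (h : Ch lab s) (hs : s.Nonempty) :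
    ∃ x ∈ s, ∀ y ∈ s, lab x ⊆ lab y := by
  obtain ⟨x, hx, hmin⟩ := Finset.exists_min_image s (fun x => (lab x).card) hs
  refine ⟨x, hx, fun y hy => ?_⟩
  rcases h x hx y hy with h' | h'
  · exact h'
  · exact (Finset.eq_of_subset_of_card_le h' (hmin y hy)).symm ▸ subset_rfl

/-- Existence of the map from faces (indexed by complements) to chains of labels. -/
lemma exists_q (lab : Q → Finset U) (K : Finset U → Prop)
    (hK : ∀ ⦃σ τ : Finset U⦄, K τ → σ ⊆ τ → K σ) (c : Finset U → Q)
    (hc : ∀ τ, ¬ K τ → τᶜ ⊆ lab (c τ))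
    (hmono : ∀ τ τ', ¬ K τ → ¬ K τ' → τ ⊆ τ' → lab (c τ') ⊆ lab (c τ)) :
    ∃ q : Matrix (Finset U) (Finset Q) ℚ, ∀ τ, ¬ K τ →
      (∀ s, q τ s ≠ 0 → Ch lab s ∧ ∀ x ∈ s, lab x ⊆ lab (c τ) ∧ ¬ lab x ⊆ τ) ∧
      (q τ ᵥ* Bm Q = ∑ v ∈ τᶜ, sg (insert v τ) v • q (insert v τ)) ∧
      (τ = univ → q τ = Pi.single ∅ 1) := by
  refine exists_rec (α := Finset U) (β := Finset Q → ℚ) (fun τ => τᶜ.card)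
    (fun q τ y => ¬ K τ →
      (∀ s, y s ≠ 0 → Ch lab s ∧ ∀ x ∈ s, lab x ⊆ lab (c τ) ∧ ¬ lab x ⊆ τ) ∧
      (y ᵥ* Bm Q = ∑ v ∈ τᶜ, sg (insert v τ) v • q (insert v τ)) ∧
      (τ = univ → y = Pi.single ∅ 1)) ?_ ?_
  · intro f f' τ y hff hy hτ
    obtain ⟨h1, h2, h3⟩ := hy hτ
    refine ⟨h1, ?_, h3⟩
    rw [h2]
    refine Finset.sum_congr rfl fun v hv => ?_
    rw [hff]
    refine Finset.card_lt_card ?_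
    rw [Finset.compl_ssubset_compl]
    exact Finset.ssubset_insert (by simpa using hv)
  · intro q τ ih
    by_cases hτ : K τ
    · exact ⟨0, fun h => absurd hτ h⟩
    by_cases hu : τ = univ
    · refine ⟨Pi.single ∅ 1, fun _ => ⟨?_, ?_, fun _ => rfl⟩⟩
      · intro s hs
        have : s = ∅ := by
          by_contra h
          exact hs (by simp [h])
        subst this
        exact ⟨fun x hx => by simp at hx, fun x hx => by simp at hx⟩
      · subst hu
        ext t
        rw [vecMul_Bm]
        simp
    have hne : τᶜ.Nonempty := by
      rw [Finset.nonempty_iff_ne_empty]; simpa using hu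
    have hlt : ∀ v ∈ τᶜ, (insert v τ)ᶜ.card < τᶜ.card := fun v hv => by
      refine Finset.card_lt_card ?_
      rw [Finset.compl_ssubset_compl]
      exact Finset.ssubset_insert (by simpa using hv)
    have hKi : ∀ v, ¬ K (insert v τ) := fun v h => hτ (hK h (Finset.subset_insert v τ))
    set u : Finset Q → ℚ := ∑ v ∈ τᶜ, sg (insert v τ) v • q (insert v τ) with hu'
    have huB : u ᵥ* Bm Q = 0 := by
      have e1 : u ᵥ* Bm Q = ∑ v ∈ τᶜ, sg (insert v τ) v • (∑ w ∈ (insert v τ)ᶜ,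
          sg (insert w (insert v τ)) w • q (insert w (insert v τ))) := by
        rw [hu', Matrix.sum_vecMul]
        refine Finset.sum_congr rfl fun v hv => ?_
        rw [Matrix.smul_vecMul, (ih _ (hlt v hv) (hKi v)).2.1]
      rw [e1]
      ext t
      have e2 := congrFun (show ((fun τ' => q τ' t) ᵥ* Bm U) ᵥ* Bm U = 0 by
        rw [Matrix.vecMul_vecMul, Bm_sq, Matrix.vecMul_zero]) τ
      rw [vecMul_Bm] at e2
      simp only [vecMul_Bm] at e2
      simpa [Finset.sum_apply] using e2
    refine ⟨u ᵥ* Hm (c τ), fun _ => ⟨?_, ?_, fun h => absurd h hu⟩⟩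
    · intro t ht
      obtain ⟨s, hs, hcs, rfl⟩ := vecMul_Hm _ _ _ ht
      have hs' : ∃ v ∈ τᶜ, q (insert v τ) s ≠ 0 := by
        rw [hu', Finset.sum_apply] at hs
        obtain ⟨v, hv, h⟩ := Finset.exists_ne_zero_of_sum_ne_zero hs
        refine ⟨v, hv, fun h' => h ?_⟩
        simp [h']
      obtain ⟨v, hv, hvs⟩ := hs'
      obtain ⟨h1, h2⟩ := (ih _ (hlt v hv) (hKi v)).1 s hvs
      have h3 : ∀ y ∈ s, lab y ⊆ lab (c τ) := fun y hy =>
        (h2 y hy).1.trans (hmono _ _ hτ (hKi v) (Finset.subset_insert _ _))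
      refine ⟨h1.insert fun y hy => Or.inr (h3 y hy), ?_⟩
      intro x hx
      rw [Finset.mem_insert] at hx
      rcases hx with rfl | hx
      · refine ⟨subset_rfl, fun h => ?_⟩
        obtain ⟨w, hw⟩ := hne
        have := h (hc τ hτ hw)
        simp [this] at hw
      · exact ⟨h3 x hx, fun h => (h2 x hx).2 (h.trans (Finset.subset_insert _ _))⟩
    · have e := HB (c τ)
      have e' : Hm (c τ) * Bm Q = 1 - Bm Q * Hm (c τ) := eq_sub_of_add_eq e
      rw [Matrix.vecMul_vecMul, e', Matrix.vecMul_sub, ← Matrix.vecMul_vecMul, huB]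
      simp

/-- Existence of the map from chains of labels to cochains. -/
lemma exists_g (lab : Q → Finset U) (K : Finset U → Prop) (hV : ¬ K univ)
    (fill : ∀ s, Ch lab s → ∀ x ∈ s, (∀ y ∈ s, lab x ⊆ lab y) → ∀ φ : Finset U → ℚ,
      (∀ τ, φ τ ≠ 0 → τ.card + s.card = Fintype.card U + 1 ∧ ¬ K τ ∧ lab x ⊆ τ) →
      Bm U *ᵥ φ = 0 → ∃ ψ : Finset U → ℚ,
      (∀ τ, ψ τ ≠ 0 → τ.card + s.card = Fintype.card U ∧ ¬ K τ ∧ lab x ⊆ τ) ∧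
      Bm U *ᵥ ψ = φ) :
    ∃ g : Matrix (Finset Q) (Finset U) ℚ, ∀ s,
      (∀ τ, g s τ ≠ 0 → Ch lab s ∧ τ.card + s.card = Fintype.card U ∧ ¬ K τ ∧
        (s.Nonempty → ∃ x ∈ s, lab x ⊆ τ)) ∧
      (Ch lab s → Bm U *ᵥ (g s) = ∑ v ∈ s, sg s v • g (s.erase v)) ∧
      (s = ∅ → g s = Pi.single univ 1) := by
  refine exists_rec (α := Finset Q) (β := Finset U → ℚ) (fun s => s.card)
    (fun g s y =>
      (∀ τ, y τ ≠ 0 → Ch lab s ∧ τ.card + s.card = Fintype.card U ∧ ¬ K τ ∧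
        (s.Nonempty → ∃ x ∈ s, lab x ⊆ τ)) ∧
      (Ch lab s → Bm U *ᵥ y = ∑ v ∈ s, sg s v • g (s.erase v)) ∧
      (s = ∅ → y = Pi.single univ 1)) ?_ ?_
  · rintro f f' s y hff ⟨h1, h2, h3⟩
    refine ⟨h1, ?_, h3⟩
    intro hs
    rw [h2 hs]
    refine Finset.sum_congr rfl fun v hv => ?_
    rw [hff]
    exact Finset.card_erase_lt_of_mem hv
  · intro g s ih
    by_cases hch : Ch lab s
    swap
    · refine ⟨0, by simp, fun h => absurd h hch, ?_⟩
      rintro rfl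
      exact absurd (fun x hx => by simp at hx) hch
    rcases s.eq_empty_or_nonempty with rfl | hne
    · refine ⟨Pi.single univ 1, ?_, ?_, fun _ => rfl⟩
      · intro τ hτ
        have : τ = univ := by
          by_contra h
          exact hτ (by simp [h])
        subst this
        exact ⟨hch, by simp, hV, by simp⟩
      · intro _
        ext τ
        rw [Bm_mulVec]
        simp only [Finset.sum_empty, Pi.zero_apply]
        refine Finset.sum_eq_zero fun v hv => ?_
        rw [Pi.single_eq_of_ne, mul_zero]
        intro h
        have := Finset.mem_univ v
        rw [← h] at this
        simp at this
    obtain ⟨x, hx, hmin⟩ := hch.exists_min hne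
    have hlt : ∀ v ∈ s, (s.erase v).card < s.card := fun v hv => Finset.card_erase_lt_of_mem hv
    have hche : ∀ v, Ch lab (s.erase v) := fun v => hch.subset (Finset.erase_subset v s)
    set φ : Finset U → ℚ := ∑ v ∈ s, sg s v • g (s.erase v) with hφ
    have hφB : Bm U *ᵥ φ = 0 := by
      have e1 : Bm U *ᵥ φ = ∑ v ∈ s, sg s v • (∑ w ∈ s.erase v,
          sg (s.erase v) w • g ((s.erase v).erase w)) := by
        rw [hφ, Matrix.mulVec_sum]
        refine Finset.sum_congr rfl fun v hv => ?_
        rw [Matrix.mulVec_smul, (ih _ (hlt v hv)).2.1 (hche v)]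
      rw [e1]
      ext t
      have e2 := congrFun (cob_cob (fun s' => g s' t)) s
      rw [Bm_mulVec] at e2
      simp only [Bm_mulVec] at e2
      simpa [Finset.sum_apply] using e2
    obtain ⟨ψ, hψ1, hψ2⟩ := fill s hch x hx hmin φ (by
      intro τ hτ
      rw [hφ, Finset.sum_apply] at hτ
      obtain ⟨v, hv, h⟩ := Finset.exists_ne_zero_of_sum_ne_zero hτ
      have h' : g (s.erase v) τ ≠ 0 := fun h' => h (by simp [h'])
      obtain ⟨_, h1, h2, h3⟩ := (ih _ (hlt v hv)).1 τ h'
      have hcard := Finset.card_erase_add_one hv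
      refine ⟨by omega, h2, ?_⟩
      by_cases hne' : (s.erase v).Nonempty
      · obtain ⟨y, hy, hyτ⟩ := h3 hne'
        exact (hmin y (Finset.mem_of_mem_erase hy)).trans hyτ
      · rw [Finset.not_nonempty_iff_eq_empty] at hne'
        rw [hne', Finset.card_empty, add_zero] at h1
        rw [(Finset.card_eq_iff_eq_univ τ).1 h1]
        exact Finset.subset_univ _) hφB
    refine ⟨ψ, ?_, fun _ => hψ2, fun h => absurd h hne.ne_empty⟩
    intro τ hτ
    obtain ⟨h1, h2, h3⟩ := hψ1 τ hτ
    exact ⟨hch, h1, h2, fun _ => ⟨x, hx, h3⟩⟩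

theorem top_core (lab : Q → Finset U) (K : Finset U → Prop)
    (hK : ∀ ⦃σ τ : Finset U⦄, K τ → σ ⊆ τ → K σ) (hV : ¬ K univ) (c : Finset U → Q)
    (hc : ∀ τ, ¬ K τ → τᶜ ⊆ lab (c τ))
    (hmono : ∀ τ τ', ¬ K τ → ¬ K τ' → τ ⊆ τ' → lab (c τ') ⊆ lab (c τ))
    (b : Q) (hb : ∀ x, lab b ⊆ lab x)
    (fill : ∀ s, Ch lab s → ∀ x ∈ s, (∀ y ∈ s, lab x ⊆ lab y) → ∀ φ : Finset U → ℚ,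
      (∀ τ, φ τ ≠ 0 → τ.card + s.card = Fintype.card U + 1 ∧ ¬ K τ ∧ lab x ⊆ τ) →
      Bm U *ᵥ φ = 0 → ∃ ψ : Finset U → ℚ,
      (∀ τ, ψ τ ≠ 0 → τ.card + s.card = Fintype.card U ∧ ¬ K τ ∧ lab x ⊆ τ) ∧
      Bm U *ᵥ ψ = φ) : False := by
  classical
  obtain ⟨q, hq⟩ := exists_q lab K hK c hc hmono
  obtain ⟨g, hg⟩ := exists_g lab K hV fill
  let π : Matrix (Finset Q) (Finset Q) ℚ := Matrix.diagonal fun s => if Ch lab s then 1 else 0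
  let J : Matrix (Finset Q) (Finset Q) ℚ := Matrix.diagonal fun s => (-1) ^ s.card
  have hπ : ∀ (M : Matrix (Finset Q) (Finset Q) ℚ) s t,
      (π * M) s t = if Ch lab s then M s t else 0 := by
    intro M s t; simp [π, Matrix.diagonal_mul]
  have hπ' : ∀ (M : Matrix (Finset Q) (Finset Q) ℚ) s t,
      (M * π) s t = if Ch lab t then M s t else 0 := by
    intro M s t; simp [π, Matrix.mul_diagonal]
  have hBne : ∀ s t, Bm Q s t ≠ 0 → ∃ v ∈ s, t = s.erase v := by
    intro s t h
    obtain ⟨v, hv, h'⟩ := Finset.exists_ne_zero_of_sum_ne_zero h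
    refine ⟨v, hv, ?_⟩
    by_contra hh
    simp [hh] at h'
  have hHne : ∀ s t, Hm b s t ≠ 0 → t = insert b s := by
    intro s t h
    by_contra hh
    apply h
    simp [Hm, hh]
  have hπB : π * Bm Q * π = π * Bm Q := by
    ext s t
    rw [hπ', hπ]
    split_ifs with h1 h2
    · rfl
    · rfl
    · by_contra h3
      obtain ⟨v, hv, rfl⟩ := hBne s t (Ne.symm h3)
      exact h1 (Ch.subset ‹_› (Finset.erase_subset _ _))
    · rfl
  have hπH : π * Hm b * π = π * Hm b := by
    ext s t
    rw [hπ', hπ]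
    split_ifs with h1 h2
    · rfl
    · rfl
    · by_contra h3
      obtain rfl := hHne s t (Ne.symm h3)
      exact h1 (Ch.insert ‹_› (fun y _ => Or.inl (hb y)))
    · rfl
  have hgq : ∀ s t, (g * q) s t ≠ 0 → ∃ τ, g s τ ≠ 0 ∧ q τ t ≠ 0 := by
    intro s t h
    rw [Matrix.mul_apply] at h
    obtain ⟨τ, _, h'⟩ := Finset.exists_ne_zero_of_sum_ne_zero h
    exact ⟨τ, left_ne_zero_of_mul h', right_ne_zero_of_mul h'⟩
  have h0 : Matrix.trace (J * (g * q)) = 0 := by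
    refine trace_lemma J (π * Bm Q) (π * Hm b) (g * q) π ?_ ?_ ?_ ?_
    · rw [← Matrix.mul_assoc, ← Matrix.mul_assoc, hπH, hπB, Matrix.mul_assoc, Matrix.mul_assoc,
        ← Matrix.mul_add, HB, Matrix.mul_one]
    · ext s t
      rw [hπ']
      split_ifs with h
      · rfl
      · by_contra h'
        obtain ⟨τ, h1, h2⟩ := hgq s t (Ne.symm h')
        exact h ((hq τ ((hg s).1 τ h1).2.2.1).1 t h2).1
    · have e1 : g * q * π = g * q := by
        ext s t
        rw [hπ']
        split_ifs with h
        · rfl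
        · by_contra h'
          obtain ⟨τ, h1, h2⟩ := hgq s t (Ne.symm h')
          exact h ((hq τ ((hg s).1 τ h1).2.2.1).1 t h2).1
      have e2 : g * (Bm U)ᵀ = π * Bm Q * g := by
        ext s τ
        have l : (g * (Bm U)ᵀ) s τ = (Bm U *ᵥ g s) τ := by
          simp [Matrix.mul_apply, Matrix.mulVec, dotProduct, mul_comm]
        rw [l]
        have r : (π * Bm Q * g) s τ = if Ch lab s then (Bm Q *ᵥ (fun s' => g s' τ)) s else 0 := by
          rw [Matrix.mul_apply]
          simp only [hπ]
          split_ifs <;> simp [Matrix.mulVec, dotProduct]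
        rw [r]
        split_ifs with h
        · rw [(hg s).2.1 h, Bm_mulVec]
          simp [Finset.sum_apply]
        · have : g s = 0 := by
            ext τ'
            by_contra h'
            exact h ((hg s).1 τ' h').1
          simp [this]
      have e3 : g * (q * Bm Q) = g * ((Bm U)ᵀ * q) := by
        ext s t
        rw [Matrix.mul_apply, Matrix.mul_apply]
        refine Finset.sum_congr rfl fun τ _ => ?_
        by_cases h : g s τ = 0
        · simp [h]
        congr 1
        have hτ := ((hg s).1 τ h).2.2.1
        have l : (q * Bm Q) τ t = (q τ ᵥ* Bm Q) t := by
          simp [Matrix.mul_apply, Matrix.vecMul, dotProduct]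
        have r : ((Bm U)ᵀ * q) τ t = ((fun τ' => q τ' t) ᵥ* Bm U) τ := by
          simp [Matrix.mul_apply, Matrix.vecMul, dotProduct, mul_comm]
        rw [l, r, (hq τ hτ).2.1, vecMul_Bm]
        simp [Finset.sum_apply]
      calc g * q * (π * Bm Q) = g * q * π * Bm Q := by simp only [Matrix.mul_assoc]
        _ = g * (q * Bm Q) := by rw [e1, Matrix.mul_assoc]
        _ = g * (Bm U)ᵀ * q := by rw [e3, Matrix.mul_assoc]
        _ = π * Bm Q * (g * q) := by rw [e2]; simp only [Matrix.mul_assoc]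
    · ext s t
      rw [Matrix.neg_apply, Matrix.diagonal_mul, Matrix.mul_diagonal]
      by_cases h : Bm Q s t = 0
      · simp [hπ, h]
      · obtain ⟨v, hv, rfl⟩ := hBne s t h
        have := Finset.card_erase_add_one hv
        rw [← this, pow_succ]; ring
  have h1 : Matrix.trace (J * (g * q)) = 1 := by
    rw [Matrix.trace, Finset.sum_eq_single ∅]
    · rw [Matrix.diag_apply, Matrix.diagonal_mul]
      simp only [Finset.card_empty, pow_zero, one_mul]
      rw [Matrix.mul_apply, Finset.sum_eq_single univ]
      · rw [(hg ∅).2.2 rfl, (hq univ hV).2.2 rfl]; simp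
      · intro τ _ h
        rw [(hg ∅).2.2 rfl]; simp [h]
      · simp
    · intro s _ hs
      rw [Matrix.diag_apply, Matrix.diagonal_mul]
      by_contra h
      obtain ⟨τ, h1, h2⟩ := hgq s s (right_ne_zero_of_mul h)
      obtain ⟨_, _, h3, h4⟩ := (hg s).1 τ h1
      obtain ⟨x, hx, hxτ⟩ := h4 (Finset.nonempty_iff_ne_empty.2 hs)
      exact (((hq τ h3).1 s h2).2 x hx).2 hxτ
    · simp
  rw [h0] at h1
  exact zero_ne_one h1

end top

section leray
variable {U : Type*} [LinearOrder U] [Fintype U]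

lemma extend_rat {A B : Type*} [AddCommGroup A] [AddCommGroup B]
    (f : A →ₗ[ℤ] B) (Ψ : A →ₗ[ℤ] ℚ) (h : ∀ x, f x = 0 → Ψ x = 0) :
    ∃ χ : B →ₗ[ℤ] ℚ, ∀ x, χ (f x) = Ψ x := by
  have hker : LinearMap.ker f ≤ LinearMap.ker Ψ := fun x hx => h x hx
  let e := (LinearMap.ker f).liftQ f le_rfl
  have he : Function.Injective e := by
    rw [← LinearMap.ker_eq_bot]
    exact Submodule.ker_liftQ_eq_bot _ _ _ le_rfl
  let g := (LinearMap.ker f).liftQ Ψ hker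
  obtain ⟨χ, hχ⟩ := Module.Baer.extension_property (Module.Baer.of_divisible ℚ) e he g
  refine ⟨χ, fun x => ?_⟩
  have := LinearMap.congr_fun hχ (Submodule.Quotient.mk x)
  simpa [e, g] using this

lemma leray_coh (d : ℕ) (K : Finset U → Prop) [DecidablePred K]
    (hcomplex : ∀ ⦃σ τ : Finset U⦄, K τ → σ ⊆ τ → K σ)
    (hL : IsDLeray d K) (W : Finset U) (i : ℕ) (hi : d ≤ i) (ψ : Finset U → ℚ)
    (hψ : ∀ τ, K τ → τ ⊆ W → τ.card = i + 2 → (Bm U *ᵥ ψ) τ = 0) :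
    ∃ χ : Finset U → ℚ, (∀ τ, χ τ ≠ 0 → τ.card = i) ∧
      ∀ τ, K τ → τ ⊆ W → τ.card = i + 1 → (Bm U *ᵥ χ) τ = ψ τ := by
  classical
  have key : ∀ (n : ℕ) (L : Chains (fun σ => K σ ∧ σ ⊆ W) n →ₗ[ℤ] ℚ) (g : Finset U → ℚ)
      (_ : ∀ σ, L (Finsupp.single σ 1) = g σ.1) (σ : {σ : Finset U // (K σ ∧ σ ⊆ W) ∧ σ.card = n + 1}),
      L (bd (fun σ => K σ ∧ σ ⊆ W) n (Finsupp.single σ 1)) = (Bm U *ᵥ g) σ.1 := by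
    intro n L g hg σ
    rw [Bm_mulVec, bd, Finsupp.lsum_single, LinearMap.toSpanSingleton_apply, one_smul, map_sum,
      ← Finset.sum_attach σ.1]
    refine Finset.sum_congr rfl fun v _ => ?_
    have hv : K (σ.1.erase v.1) ∧ σ.1.erase v.1 ⊆ W :=
      ⟨hcomplex σ.2.1.1 (Finset.erase_subset _ _), (Finset.erase_subset _ _).trans σ.2.1.2⟩
    rw [dif_pos hv, map_smul, hg, sg]
    simp
  let Ψ : Chains (fun σ => K σ ∧ σ ⊆ W) (i + 1) →ₗ[ℤ] ℚ :=
    Finsupp.lsum ℤ fun σ => LinearMap.toSpanSingleton ℤ ℚ (ψ σ.1)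
  have hΨ : ∀ σ, Ψ (Finsupp.single σ 1) = ψ σ.1 := by
    intro σ
    simp [Ψ]
  obtain ⟨χ, hχ⟩ := extend_rat (bd (fun σ => K σ ∧ σ ⊆ W) i) Ψ (by
    intro x hx
    have hs := hL W i hi
    have hx' : x ∈ cycles (fun σ => K σ ∧ σ ⊆ W) (i + 1) := hx
    have h0 : (Submodule.Quotient.mk ⟨x, hx'⟩ : RHom (fun σ => K σ ∧ σ ⊆ W) (i + 1)) = 0 :=
      Subsingleton.elim _ _
    rw [Submodule.Quotient.mk_eq_zero] at h0
    obtain ⟨y, hy⟩ := h0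
    have hy' : bd (fun σ => K σ ∧ σ ⊆ W) (i + 1) y = x := hy
    rw [← hy']
    have : Ψ ∘ₗ bd (fun σ => K σ ∧ σ ⊆ W) (i + 1) = 0 := by
      refine Finsupp.lhom_ext' fun σ => LinearMap.ext_ring ?_
      have := key (i + 1) Ψ ψ hΨ σ
      simp only [LinearMap.comp_apply, Finsupp.lsingle_apply, LinearMap.zero_apply]
      rw [this]
      exact hψ _ σ.2.1.1 σ.2.1.2 σ.2.2
    exact LinearMap.congr_fun this y)
  let g : Finset U → ℚ := fun τ =>
    if h : (K τ ∧ τ ⊆ W) ∧ τ.card = i then χ (Finsupp.single ⟨τ, h⟩ 1) else 0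
  refine ⟨g, ?_, ?_⟩
  · intro τ hτ
    by_contra h
    exact hτ (dif_neg fun h' => h h'.2)
  · intro τ h1 h2 h3
    have := key i χ g (fun σ => by simp only [g]; rw [dif_pos σ.2]) ⟨τ, ⟨h1, h2⟩, h3⟩
    rw [← this, hχ, hΨ]

lemma Bm_ne {φ : Finset U → ℚ} {τ : Finset U} (h : (Bm U *ᵥ φ) τ ≠ 0) :
    ∃ u ∈ τ, φ (τ.erase u) ≠ 0 := by
  rw [Bm_mulVec] at h
  obtain ⟨u, hu, h⟩ := Finset.exists_ne_zero_of_sum_ne_zero h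
  exact ⟨u, hu, right_ne_zero_of_mul h⟩

lemma Bm_congr {φ ψ : Finset U → ℚ} {τ : Finset U} (h : ∀ u ∈ τ, φ (τ.erase u) = ψ (τ.erase u)) :
    (Bm U *ᵥ φ) τ = (Bm U *ᵥ ψ) τ := by
  rw [Bm_mulVec, Bm_mulVec]
  exact Finset.sum_congr rfl fun u hu => by rw [h u hu]

lemma fill_leray (d : ℕ) (K : Finset U → Prop) [DecidablePred K]
    (hcomplex : ∀ ⦃σ τ : Finset U⦄, K τ → σ ⊆ τ → K σ)
    (hL : IsDLeray d K) (F : Finset U) : ∀ (W : Finset U), F ⊆ W → ∀ (i : ℕ),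
    d + 1 + F.card ≤ i → ∀ φ : Finset U → ℚ,
    (∀ τ, τ ⊆ W → φ τ ≠ 0 → τ.card = i + 1 ∧ ¬ K τ ∧ F ⊆ τ) →
    (∀ τ, τ ⊆ W → (Bm U *ᵥ φ) τ = 0) →
    ∃ ψ : Finset U → ℚ, (∀ τ, τ ⊆ W → ψ τ ≠ 0 → τ.card = i ∧ ¬ K τ ∧ F ⊆ τ) ∧
      ∀ τ, τ ⊆ W → (Bm U *ᵥ ψ) τ = φ τ := by
  induction F using Finset.induction_on with
  | empty =>
    intro W _ i hi φ hφ hB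
    rcases W.eq_empty_or_nonempty with rfl | ⟨w, hw⟩
    · refine ⟨0, by simp, ?_⟩
      intro τ hτ
      rw [Matrix.mulVec_zero]
      by_contra h
      have := (hφ τ hτ (fun h' => h (by rw [h']; rfl))).1
      rw [Finset.subset_empty.1 hτ] at this
      simp at this
    obtain ⟨j, rfl⟩ : ∃ j, i = j + 1 := ⟨i - 1, by omega⟩
    have h1 : ∀ τ, τ ⊆ W → (Bm U *ᵥ (Hm w *ᵥ φ)) τ = φ τ := by
      intro τ hτ
      have h := congrFun (con_cob w φ) τ
      rw [Pi.add_apply, Hm_mulVec, hB _ (Finset.insert_subset hw hτ)] at h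
      simpa using h
    have hs : ∀ τ, τ ⊆ W → (Hm w *ᵥ φ) τ ≠ 0 → τ.card = j + 1 := by
      intro τ hτ h
      rw [Hm_mulVec] at h
      split_ifs at h with hwτ
      · exact absurd rfl h
      have := (hφ _ (Finset.insert_subset hw hτ) (right_ne_zero_of_mul h)).1
      rw [Finset.card_insert_of_notMem hwτ] at this
      omega
    obtain ⟨χ, hχ1, hχ2⟩ := leray_coh d K hcomplex hL W j (by simp at hi; omega) (Hm w *ᵥ φ) (by
      intro τ h2 h3 _
      rw [h1 τ h3]
      by_contra h
      exact (hφ τ h3 h).2.1 h2)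
    refine ⟨Hm w *ᵥ φ - Bm U *ᵥ χ, ?_, ?_⟩
    · intro τ hτ h
      have hc : τ.card = j + 1 := by
        by_cases h0 : (Hm w *ᵥ φ) τ = 0
        · rw [Pi.sub_apply, h0, zero_sub, neg_ne_zero] at h
          obtain ⟨u, hu, h⟩ := Bm_ne h
          have := hχ1 _ h
          rw [← Finset.card_erase_add_one hu, this]
        · exact hs τ hτ h0
      refine ⟨hc, fun hK => h ?_, Finset.empty_subset _⟩
      rw [Pi.sub_apply, hχ2 τ hK hτ hc, sub_self]
    · intro τ hτ
      rw [Matrix.mulVec_sub, cob_cob, sub_zero, h1 τ hτ]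
  | insert v F hv ih =>
    intro W hFW i hi φ hφ hB
    rw [Finset.card_insert_of_notMem hv] at hi
    obtain ⟨j, rfl⟩ : ∃ j, i = j + 1 := ⟨i - 1, by omega⟩
    obtain ⟨ψ, hψ1, hψ2⟩ := ih W ((Finset.subset_insert _ _).trans hFW) (j + 1) (by omega) φ
      (fun τ hτ h => ⟨(hφ τ hτ h).1, (hφ τ hτ h).2.1,
        (Finset.subset_insert _ _).trans (hφ τ hτ h).2.2⟩) hB
    have hvW := Finset.erase_subset v W
    obtain ⟨χ, hχ1, hχ2⟩ := ih (W.erase v)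
      (Finset.subset_erase.2 ⟨(Finset.subset_insert _ _).trans hFW, hv⟩) j (by omega) ψ
      (fun τ hτ h => hψ1 τ (hτ.trans hvW) h) (by
        intro τ hτ
        rw [hψ2 τ (hτ.trans hvW)]
        by_contra h
        exact (Finset.subset_erase.1 hτ).2 ((hφ τ (hτ.trans hvW) h).2.2 (Finset.mem_insert_self _ _)))
    let χ' : Finset U → ℚ := fun τ => if τ ⊆ W.erase v then χ τ else 0
    refine ⟨ψ - Bm U *ᵥ χ', ?_, ?_⟩
    · intro τ hτ h
      have hvτ : v ∈ τ := by
        by_contra hvτ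
        have h1 : τ ⊆ W.erase v := Finset.subset_erase.2 ⟨hτ, hvτ⟩
        apply h
        have h2 : (Bm U *ᵥ χ') τ = (Bm U *ᵥ χ) τ := Bm_congr fun u _ =>
          if_pos ((Finset.erase_subset _ _).trans h1)
        rw [Pi.sub_apply, h2, hχ2 τ h1, sub_self]
      have h3 : τ.card = j + 1 ∧ ¬ K τ ∧ F ⊆ τ := by
        by_cases h0 : ψ τ = 0
        · rw [Pi.sub_apply, h0, zero_sub, neg_ne_zero] at h
          obtain ⟨u, hu, h⟩ := Bm_ne h
          have h4 : τ.erase u ⊆ W.erase v := by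
            by_contra h4
            exact h (if_neg h4)
          have h5 : χ (τ.erase u) ≠ 0 := by
            simpa only [χ', if_pos h4] using h
          obtain ⟨a, b, c⟩ := hχ1 _ h4 h5
          exact ⟨by rw [← Finset.card_erase_add_one hu, a],
            fun hK => b (hcomplex hK (Finset.erase_subset _ _)),
            c.trans (Finset.erase_subset _ _)⟩
        · exact hψ1 τ hτ h0
      exact ⟨h3.1, h3.2.1, Finset.insert_subset hvτ h3.2.2⟩
    · intro τ hτ
      rw [Matrix.mulVec_sub, cob_cob, sub_zero, hψ2 τ hτ]

lemma fill_cone (K : Finset U → Prop)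
    (hcomplex : ∀ ⦃σ τ : Finset U⦄, K τ → σ ⊆ τ → K σ) (F : Finset U) (hF : ¬ K F)
    (hu : F ≠ univ) (i : ℕ) (φ : Finset U → ℚ)
    (hφ : ∀ τ, φ τ ≠ 0 → τ.card = i + 1 ∧ ¬ K τ ∧ F ⊆ τ) (hB : Bm U *ᵥ φ = 0) :
    ∃ ψ : Finset U → ℚ, (∀ τ, ψ τ ≠ 0 → τ.card = i ∧ ¬ K τ ∧ F ⊆ τ) ∧ Bm U *ᵥ ψ = φ := by
  obtain ⟨v, hv⟩ : ∃ v, v ∉ F := by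
    by_contra! h
    exact hu (Finset.eq_univ_iff_forall.2 h)
  refine ⟨Hm v *ᵥ φ, ?_, ?_⟩
  · intro τ h
    rw [Hm_mulVec] at h
    split_ifs at h with hvτ
    · exact absurd rfl h
    obtain ⟨a, b, c⟩ := hφ _ (right_ne_zero_of_mul h)
    rw [Finset.card_insert_of_notMem hvτ] at a
    have hFτ : F ⊆ τ := by
      intro x hx
      rcases Finset.mem_insert.1 (c hx) with rfl | h'
      · exact absurd hx hv
      · exact h'
    exact ⟨by omega, fun hK => hF (hcomplex hK hFτ), hFτ⟩
  · have := con_cob v φ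
    rwa [hB, Matrix.mulVec_zero, zero_add] at this

end leray


section matroid
variable {U : Type*} [LinearOrder U] [Fintype U]

lemma le_matRank_iff (Ind : Finset U → Prop) [DecidablePred Ind] (hM : IsMatroid Ind) {k : ℕ}
    (hk : 1 ≤ k) (W : Finset U) :
    k ≤ matRank Ind W ↔ ∃ I, I ⊆ W ∧ Ind I ∧ I.card = k := by
  rw [matRank, Finset.le_sup_iff (by exact hk)]
  simp only [mem_filter, mem_powerset]
  constructor
  · rintro ⟨I, ⟨h1, h2⟩, h3⟩
    obtain ⟨J, hJ, hJk⟩ := Finset.exists_subset_card_eq h3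
    exact ⟨J, hJ.trans h1, hM.subset h2 hJ, hJk⟩
  · rintro ⟨I, h1, h2, h3⟩
    exact ⟨I, ⟨h1, h2⟩, h3.ge⟩

lemma matroid_data (Ind : Finset U → Prop) [DecidablePred Ind] (hM : IsMatroid Ind) {k : ℕ}
    (hk : 1 ≤ k) (hr : k ≤ matRank Ind univ) :
    ∃ (cl : Finset U → Finset U) (ρ : Finset U → ℕ),
      (∀ σ, σ ⊆ cl σ) ∧ (∀ σ τ, σ ⊆ τ → cl σ ⊆ cl τ) ∧ (∀ σ, cl (cl σ) = cl σ) ∧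
      (∀ σ, ρ (cl σ) = ρ σ) ∧ (∀ σ τ, cl σ = σ → cl τ = τ → σ ⊂ τ → ρ σ < ρ τ) ∧
      (∀ F, k ≤ matRank Ind (univ \ F) → ρ F = F.card) ∧
      (∀ R σ, R ≤ ρ σ → ∃ I, I ⊆ σ ∧ I.card = R ∧ k ≤ matRank Ind (univ \ I)) ∧
      Fintype.card U ≤ ρ univ + k := by
  classical
  let M0 : IndepMatroid U := IndepMatroid.ofFinset Set.univ (fun I => Ind I ∧ I.card ≤ k)
    ⟨hM.empty, by simp⟩ (fun I J h hIJ => ⟨hM.subset h.1 hIJ, (Finset.card_le_card hIJ).trans h.2⟩)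
    (fun I J hI hJ hlt => by
      obtain ⟨x, h1, h2, h3⟩ := hM.exchange hI.1 hJ.1 hlt
      refine ⟨x, h1, h2, h3, ?_⟩
      rw [Finset.card_insert_of_notMem h2]
      exact Nat.succ_le_of_lt (hlt.trans_le hJ.2)) (fun _ _ => Set.subset_univ _)
  let M : Matroid U := M0.matroid
  have hE : M.E = Set.univ := rfl
  have hInd : ∀ I : Finset U, M.Indep I ↔ Ind I ∧ I.card ≤ k := by
    intro I
    change M0.Indep I ↔ _
    simp only [M0, IndepMatroid.ofFinset_indep]
  have hrk : M.eRank ≤ k := by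
    rw [← Matroid.eRk_ground, Matroid.eRk_le_iff]
    intro I _ hI
    have h := (hInd I.toFinset).1 (by simpa using hI)
    rw [← Set.coe_toFinset I, Set.encard_coe_eq_coe_finsetCard]
    exact_mod_cast h.2
  have hbase : ∀ I : Finset U, Ind I → I.card = k → M.IsBase I := by
    intro I h1 h2
    have hI := (hInd I).2 ⟨h1, h2.le⟩
    refine hI.isBase_of_eRk_ge I.finite_toSet ?_
    rw [hI.eRk_eq_encard, Set.encard_coe_eq_coe_finsetCard, h2]
    exact hrk
  obtain ⟨B0, -, hB0, hB0k⟩ := (le_matRank_iff Ind hM hk _).1 hr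
  have hrk' : M.eRank = k := by
    rw [← (hbase B0 hB0 hB0k).encard_eq_eRank, Set.encard_coe_eq_coe_finsetCard, hB0k]
  have hN : ∀ I : Finset U, M✶.Indep I ↔ k ≤ matRank Ind (univ \ I) := by
    intro I
    rw [Matroid.dual_indep_iff_exists (Set.subset_univ _), le_matRank_iff Ind hM hk]
    constructor
    · rintro ⟨B, hB, hd⟩
      have h := (hInd B.toFinset).1 (by simpa using hB.indep)
      refine ⟨B.toFinset, ?_, h.1, ?_⟩
      · intro x hx
        simp only [mem_sdiff, mem_univ, true_and]
        intro hxI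
        exact Set.disjoint_left.1 hd (by simpa using hxI) (by simpa using hx)
      · have := hB.encard_eq_eRank
        rw [hrk', ← Set.coe_toFinset B, Set.encard_coe_eq_coe_finsetCard] at this
        exact_mod_cast this
    · rintro ⟨B, h1, h2, h3⟩
      refine ⟨B, hbase B h2 h3, ?_⟩
      rw [Set.disjoint_left]
      intro x hx hx'
      have := h1 (Finset.mem_coe.1 hx')
      simp at this
      exact this (by simpa using hx)
  have hNE : M✶.E = Set.univ := rfl
  have hcl : ∀ σ : Finset U, (((M✶.closure σ).toFinset : Finset U) : Set U) = M✶.closure σ :=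
    fun σ => Set.coe_toFinset _
  have hfin : ∀ X : Set U, M✶.eRk X ≠ ⊤ := fun X =>
    ((M✶.eRk_le_encard X).trans_lt (Set.encard_lt_top_iff.2 X.toFinite)).ne
  have hρ : ∀ X : Set U, ((M✶.eRk X).toNat : ℕ∞) = M✶.eRk X := fun X => ENat.natCast_toNat (hfin X)
  refine ⟨fun σ => (M✶.closure σ).toFinset, fun σ => (M✶.eRk σ).toNat, ?_, ?_, ?_, ?_, ?_, ?_, ?_, ?_⟩
  · intro σ x hx
    rw [Set.mem_toFinset]
    exact M✶.subset_closure (σ : Set U) (Set.subset_univ _) hx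
  · intro σ τ h
    exact Set.toFinset_subset_toFinset.2 (M✶.closure_subset_closure (by simpa using h))
  · intro σ
    simp only [hcl, Matroid.closure_closure]
  · intro σ
    simp only [hcl, Matroid.eRk_closure_eq]
  · intro σ τ h1 h2 h3
    by_contra h
    push Not at h
    have h' : M✶.eRk τ ≤ M✶.eRk σ := by
      rw [← hρ τ, ← hρ σ]
      exact_mod_cast h
    have := Matroid.IsRkFinite.closure_eq_closure_of_subset_of_eRk_ge_eRk
      (Matroid.eRk_ne_top_iff.1 (hfin (σ : Set U))) (by simpa using h3.subset) h'
    have h4 : σ = τ := by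
      rw [← h1, ← h2]
      simp only [this]
    exact h3.ne h4
  · intro F hF
    have := ((hN F).2 hF).eRk_eq_encard
    simp only [this, Set.encard_coe_eq_coe_finsetCard, ENat.toNat_natCast]
  · intro R σ hR
    have h : (R : ℕ∞) ≤ M✶.eRk σ := by
      rw [← hρ]
      exact_mod_cast hR
    obtain ⟨I, hI1, hI2, hI3⟩ := Matroid.le_eRk_iff.1 h
    refine ⟨I.toFinset, ?_, ?_, ?_⟩
    · intro x hx
      exact hI1 (by simpa using hx)
    · rw [← Set.coe_toFinset I, Set.encard_coe_eq_coe_finsetCard] at hI3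
      exact_mod_cast hI3
    · rw [← hN]
      simpa using hI2
  · have h1 : M✶.Indep ((univ \ B0 : Finset U) : Set U) := by
      rw [hN, le_matRank_iff Ind hM hk]
      exact ⟨B0, by simp, hB0, hB0k⟩
    have h2 := h1.encard_le_eRk_of_subset (X := ((univ : Finset U) : Set U)) (by simp)
    rw [← hρ, Set.encard_coe_eq_coe_finsetCard] at h2
    have h3 : (univ \ B0 : Finset U).card ≤ (M✶.eRk ((univ : Finset U) : Set U)).toNat := by
      exact_mod_cast h2
    rw [Finset.card_sdiff_of_subset (Finset.subset_univ _), hB0k, Finset.card_univ] at h3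
    change _ ≤ (M✶.eRk ((univ : Finset U) : Set U)).toNat + k
    omega

lemma main_aux (d r k : ℕ) (hr : d + 1 ≤ r) (hk1 : 1 ≤ k) (hk : k ≤ d + 1)
    (K : Finset U → Prop) [DecidablePred K]
    (hcomplex : ∀ ⦃σ τ : Finset U⦄, K τ → σ ⊆ τ → K σ)
    (hLeray : IsDLeray d K)
    (Ind : Finset U → Prop) [DecidablePred Ind] (hM : IsMatroid Ind)
    (hrank : matRank Ind Finset.univ = r)
    (hyp : ∀ σ : Finset U, σ.card = d + 1 → k ≤ matRank Ind σ → K σ) :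
    ∃ τ : Finset U, K τ ∧ matRank Ind (Finset.univ \ τ) ≤ k - 1 := by
  classical
  by_contra hcon
  have hneg : ∀ τ, K τ → k ≤ matRank Ind (univ \ τ) := by
    intro τ hτ
    by_contra h
    exact hcon ⟨τ, hτ, by omega⟩
  have hKu : ¬ K univ := by
    intro h
    obtain ⟨I, h1, -, h3⟩ := (le_matRank_iff Ind hM hk1 _).1 (hneg _ h)
    have := Finset.card_le_card h1
    simp at this
    rw [this] at h3
    simp at h3
    omega
  have hnd : d + 1 ≤ Fintype.card U := by
    obtain ⟨I, -, -, h3⟩ := (le_matRank_iff Ind hM (k := r) (by omega) univ).1 hrank.ge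
    have := Finset.card_le_univ I
    omega
  obtain ⟨cl, ρ, cext, cmono, cidem, ρcl, ρlt, ρind, ρbig, ρuniv⟩ :=
    matroid_data Ind hM hk1 (by omega)
  obtain ⟨R, hR⟩ : ∃ R, R + (d + 1) = Fintype.card U := ⟨_, Nat.sub_add_cancel hnd⟩
  have hRlt : ∀ τ, ¬ K τ → ρ (cl τᶜ) < R := by
    intro τ hτ
    by_contra h
    push Not at h
    rw [ρcl] at h
    obtain ⟨I, h1, h2, h3⟩ := ρbig R _ h
    refine hτ (hcomplex (hyp (univ \ I) ?_ h3) ?_)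
    · rw [Finset.card_sdiff_of_subset (Finset.subset_univ _), Finset.card_univ]
      omega
    · intro x hx
      simp only [mem_sdiff, mem_univ, true_and]
      intro hxI
      exact (Finset.mem_compl.1 (h1 hxI)) hx
  let P := {F : Finset U // cl F = F ∧ ρ F < R}
  let e : P ≃ Fin (Fintype.card P) := Fintype.equivFin P
  let lab : Fin (Fintype.card P) → Finset U := fun q => (e.symm q).1
  have hlab : ∀ q, cl (lab q) = lab q ∧ ρ (lab q) < R := fun q => (e.symm q).2
  have hinj : Function.Injective lab := fun a b h => e.symm.injective (Subtype.ext h)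
  have hb0 : ρ (cl ∅) < R := by
    have := hRlt _ hKu
    rwa [Finset.compl_univ] at this
  let b := e ⟨cl ∅, cidem _, hb0⟩
  have hbl : lab b = cl ∅ := by simp [lab, b]
  let c : Finset U → Fin (Fintype.card P) := fun τ =>
    if h : ¬ K τ then e ⟨cl τᶜ, cidem _, hRlt τ h⟩ else b
  have hcl : ∀ τ, ¬ K τ → lab (c τ) = cl τᶜ := by
    intro τ h
    simp only [c, dif_pos h]
    simp [lab]
  refine top_core lab K (fun σ τ h1 h2 => ?_) hKu c ?_ ?_ b ?_ ?_
  · exact hcomplex h1 h2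
  · intro τ hτ
    rw [hcl τ hτ]
    exact cext _
  · intro τ τ' h h' hs
    rw [hcl τ h, hcl τ' h']
    exact cmono _ _ (Finset.compl_subset_compl.2 hs)
  · intro x
    rw [hbl, ← (hlab x).1]
    exact cmono _ _ (Finset.empty_subset _)
  · intro s hs x hx hmin φ hφ hB
    have hcard : s.card ≤ R - ρ (lab x) := by
      rw [← Nat.card_Ico]
      refine Finset.card_le_card_of_injOn (fun y => ρ (lab y)) ?_ ?_
      · intro y hy
        have hy' : y ∈ s := hy
        simp only [Finset.coe_Ico, Set.mem_Ico]
        refine ⟨?_, (hlab y).2⟩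
        rcases (hmin y hy').eq_or_ssubset with h | h
        · rw [h]
        · exact (ρlt _ _ (hlab x).1 (hlab y).1 h).le
      · intro y hy z hz h
        by_contra hne
        have hne' : lab y ≠ lab z := fun h => hne (hinj h)
        have h : ρ (lab y) = ρ (lab z) := h
        rcases hs y hy z hz with h1 | h1
        · exact (ρlt _ _ (hlab y).1 (hlab z).1 (h1.ssubset_of_ne hne')).ne h
        · exact (ρlt _ _ (hlab z).1 (hlab y).1 (h1.ssubset_of_ne hne'.symm)).ne h.symm
    have hs1 : 1 ≤ s.card := Finset.card_pos.2 ⟨x, hx⟩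
    obtain ⟨i, hi⟩ : ∃ i, i + s.card = Fintype.card U := ⟨_, Nat.sub_add_cancel (by omega)⟩
    have hφ' : ∀ τ, φ τ ≠ 0 → τ.card = i + 1 ∧ ¬ K τ ∧ lab x ⊆ τ := by
      intro τ h
      obtain ⟨h1, h2⟩ := hφ τ h
      exact ⟨by omega, h2⟩
    have key : ∃ ψ : Finset U → ℚ, (∀ τ, ψ τ ≠ 0 → τ.card = i ∧ ¬ K τ ∧ lab x ⊆ τ) ∧
        Bm U *ᵥ ψ = φ := by
      by_cases hcase : k ≤ matRank Ind (univ \ lab x)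
      · have h1 := ρind _ hcase
        obtain ⟨ψ, h2, h3⟩ := fill_leray d K hcomplex hLeray (lab x) univ (Finset.subset_univ _) i
          (by omega) φ (fun τ _ => hφ' τ) (fun τ _ => by rw [hB]; rfl)
        exact ⟨ψ, fun τ => h2 τ (Finset.subset_univ _),
          funext fun τ => h3 τ (Finset.subset_univ _)⟩
      · refine fill_cone K hcomplex (lab x) (fun h => hcase (hneg _ h)) ?_ i φ hφ' hB
        intro h
        have := (hlab x).2
        rw [h] at this
        omega
    obtain ⟨ψ, h1, h2⟩ := key
    refine ⟨ψ, fun τ h => ?_, h2⟩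
    obtain ⟨h3, h4⟩ := h1 τ h
    exact ⟨by omega, h4⟩

end matroid

end LerayAux

/-- If the `d`-Leray complex `X` contains every set of size `d+1` of rank at least `k`,
then some face `τ` of `X` satisfies `ρ(V ∖ τ) ≤ k - 1`. -/
theorem stmt_11 {V : Type*} [DecidableEq V] [LinearOrder V] [Fintype V]
    (d r k : ℕ) (hr : d + 1 ≤ r) (hk1 : 1 ≤ k) (hk : k ≤ d + 1)
    (K : Finset V → Prop) [DecidablePred K]
    (hcomplex : ∀ ⦃σ τ : Finset V⦄, K τ → σ ⊆ τ → K σ)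
    (hLeray : IsDLeray d K)
    (Ind : Finset V → Prop) [DecidablePred Ind] (hM : IsMatroid Ind)
    (hrank : matRank Ind Finset.univ = r)
    (hyp : ∀ σ : Finset V, σ.card = d + 1 → k ≤ matRank Ind σ → K σ) :
    ∃ τ : Finset V, K τ ∧ matRank Ind (Finset.univ \ τ) ≤ k - 1 := by
  obtain rfl : ‹DecidableEq V› = (fun a b => LinearOrder.toDecidableEq a b) :=
    Subsingleton.elim _ _
  exact LerayAux.main_aux d r k hr hk1 hk K hcomplex hLeray Ind hM hrank hyp
end
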